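/- arXiv:1512.08673 — 2 statements merged into one kernel-verified Lean document; each statement's English description precedes it below -/
import Mathlib

section
/- Let 𝒢 = {G_1,…,G_g} be a partition of 𝒩 = {1,…,n} with |G_i| ≤ k for all i. Let ‖·‖_A be a norm on ℝ^n decomposable with respect to 𝒢, and let ‖·‖_P be a norm on ℝ^n that is γ-decomposable with respect to 𝒢 for some γ ∈ (0,1]. Let a, b > 0 satisfy a‖u‖_A ≤ ‖u‖_P ≤ b‖u‖_A for every group k-sparse vector u. Let Λ_0, Λ_1, …, Λ_s be pairwise disjoint group k-sparse sets whose union is 𝒩, and let x, x̂ ∈ ℝ^n with ‖x̂‖_P ≤ ‖x‖_P. Then, writing h = x̂ − x and r = b/(aγ), we have ‖h_{Λ_0^c}‖_A ≤ r‖h_{Λ_0}‖_A + r(1+γ)‖x_{Λ_0^c}‖_A. -/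
noncomputable section

open Finset

/-- The restriction `x_Λ` of `x : ℝ^n` to the coordinates in `Λ` (zero outside `Λ`). -/
def restr {n : ℕ} (Λ : Finset (Fin n)) (x : Fin n → ℝ) : Fin n → ℝ :=
  fun i => if i ∈ Λ then x i else 0

/-- `Λ` is a group `k`-sparse set: a union of groups of the partition `G`, of cardinality `≤ k`. -/
def GkS {n g : ℕ} (G : Fin g → Finset (Fin n)) (k : ℕ) (Λ : Finset (Fin n)) : Prop :=
  (∃ S : Finset (Fin g), Λ = S.biUnion G) ∧ Λ.card ≤ k

lemma restr_union {n : ℕ} {A B : Finset (Fin n)} (hAB : Disjoint A B) (u : Fin n → ℝ) :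
    restr (A ∪ B) u = restr A u + restr B u := by
  funext i
  have hi : i ∈ A → i ∉ B := fun hA hB => Finset.disjoint_left.mp hAB hA hB
  by_cases hA : i ∈ A
  · simp [restr, hA, hi hA]
  · simp [restr, hA]

lemma restr_add {n : ℕ} (A : Finset (Fin n)) (u v : Fin n → ℝ) :
    restr A (u + v) = restr A u + restr A v := by
  funext i
  by_cases hA : i ∈ A <;> simp [restr, hA]

lemma restr_empty {n : ℕ} (u : Fin n → ℝ) : restr ∅ u = 0 := by
  funext i
  simp [restr]

lemma restr_univ {n : ℕ} (u : Fin n → ℝ) : restr Finset.univ u = u := by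
  funext i
  simp [restr]

lemma support_restr_subset {n : ℕ} (A : Finset (Fin n)) (u : Fin n → ℝ) :
    Function.support (restr A u) ⊆ ↑A := by
  intro i hi
  by_contra hA
  exact hi (if_neg hA)

/-- A subadditive function is at most the sum of its values on the blocks of a vector. -/
lemma restr_biUnion_le_sum {n : ℕ} {ι : Type*} [DecidableEq ι] {N : (Fin n → ℝ) → ℝ}
    (hzero : N 0 = 0) (hadd : ∀ u v, N (u + v) ≤ N u + N v) {Λ : ι → Finset (Fin n)}
    (hΛ : ∀ i j, i ≠ j → Disjoint (Λ i) (Λ j)) (u : Fin n → ℝ) (T : Finset ι) :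
    N (restr (T.biUnion Λ) u) ≤ ∑ i ∈ T, N (restr (Λ i) u) := by
  induction T using Finset.induction_on with
  | empty => simp [restr_empty, hzero]
  | insert i T hi ih =>
    have hd : Disjoint (Λ i) (T.biUnion Λ) :=
      (Finset.disjoint_biUnion_right _ _ _).mpr fun j hj =>
        hΛ i j (ne_of_mem_of_not_mem hj hi).symm
    rw [Finset.biUnion_insert, restr_union hd, Finset.sum_insert hi]
    exact (hadd _ _).trans (by gcongr)

/-- Superadditivity with factor `γ` across disjoint unions of groups passes to any number of
blocks, with the factor `γ` appearing only once. -/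
lemma add_mul_sum_le_restr_biUnion {n : ℕ} {κ ι : Type*} [DecidableEq κ] [DecidableEq ι]
    {G : κ → Finset (Fin n)} {N : (Fin n → ℝ) → ℝ} {γ : ℝ}
    (hdec : ∀ (u v : Fin n → ℝ) (Su Sv : Finset κ), Disjoint Su Sv →
      Function.support u ⊆ ↑(Su.biUnion G) → Function.support v ⊆ ↑(Sv.biUnion G) →
      N u + γ * N v ≤ N (u + v))
    {S : ι → Finset κ} (hS : ∀ i j, i ≠ j → Disjoint (S i) (S j))
    {Λ : ι → Finset (Fin n)} (hSΛ : ∀ i, Λ i = (S i).biUnion G)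
    (hΛ : ∀ i j, i ≠ j → Disjoint (Λ i) (Λ j)) (u : Fin n → ℝ) (i₀ : ι)
    (T : Finset ι) (hT : i₀ ∉ T) :
    N (restr (Λ i₀) u) + γ * ∑ i ∈ T, N (restr (Λ i) u) ≤
      N (restr ((insert i₀ T).biUnion Λ) u) := by
  induction T using Finset.induction_on with
  | empty => simp
  | insert i T hi ih =>
    have hi₀ : i ≠ i₀ := fun h => hT (by simp [h])
    have hne : ∀ j ∈ insert i₀ T, j ≠ i := by
      intro j hj hji
      subst hji
      exact (Finset.mem_insert.mp hj).elim hi₀ hi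
    have hd : Disjoint ((insert i₀ T).biUnion Λ) (Λ i) :=
      (Finset.disjoint_biUnion_left _ _ _).mpr fun j hj => hΛ j i (hne j hj)
    have hdS : Disjoint ((insert i₀ T).biUnion S) (S i) :=
      (Finset.disjoint_biUnion_left _ _ _).mpr fun j hj => hS j i (hne j hj)
    have hU : (insert i₀ T).biUnion Λ = ((insert i₀ T).biUnion S).biUnion G := by
      rw [Finset.biUnion_biUnion]
      exact Finset.biUnion_congr rfl fun j _ => hSΛ j
    have key := hdec (restr ((insert i₀ T).biUnion Λ) u) (restr (Λ i) u) _ _ hdS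
      (hU ▸ support_restr_subset _ u) (hSΛ i ▸ support_restr_subset _ u)
    have ih' := ih fun h => hT (Finset.mem_insert_of_mem h)
    rw [Finset.insert_comm, Finset.biUnion_insert, Finset.union_comm, restr_union hd,
      Finset.sum_insert hi]
    linarith

/-- if `‖x̂‖_P ≤ ‖x‖_P` and `Λ_0,…,Λ_s` are pairwise disjoint group `k`-sparse
sets whose union is `{1,…,n}`, then with `h = x̂ − x` and `r = b/(aγ)`,
`‖h_{Λ_0ᶜ}‖_A ≤ r‖h_{Λ_0}‖_A + r(1+γ)‖x_{Λ_0ᶜ}‖_A`.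
(Here `Λ : Fin (s+1) → _` enumerates `Λ_0,…,Λ_s`, with `Λ_0 = Λ 0`.) -/
theorem stmt8 {n g k : ℕ} (hk : 0 < k)
    (G : Fin g → Finset (Fin n))
    -- `G` is a partition of `{1,…,n}` with `|G_i| ≤ k`
    (hne : ∀ i, (G i).Nonempty)
    (hdisj : ∀ i j : Fin g, i ≠ j → Disjoint (G i) (G j))
    (hcover : Finset.univ.biUnion G = (Finset.univ : Finset (Fin n)))
    (hGcard : ∀ i, (G i).card ≤ k)
    -- `NA` is a norm on `ℝ^n`, decomposable with respect to `G`
    (NA : (Fin n → ℝ) → ℝ)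
    (hNA_add : ∀ u v : Fin n → ℝ, NA (u + v) ≤ NA u + NA v)
    (hNA_smul : ∀ (t : ℝ) (u : Fin n → ℝ), NA (t • u) = |t| * NA u)
    (hNA_def : ∀ u : Fin n → ℝ, NA u = 0 ↔ u = 0)
    (hNAdec : ∀ (u v : Fin n → ℝ) (Su Sv : Finset (Fin g)), Disjoint Su Sv →
      Function.support u ⊆ ↑(Su.biUnion G) → Function.support v ⊆ ↑(Sv.biUnion G) →
      NA (u + v) = NA u + NA v)
    -- `NP` is a norm on `ℝ^n`, γ-decomposable with respect to `G` for some `γ ∈ (0,1]`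
    (NP : (Fin n → ℝ) → ℝ)
    (hNP_add : ∀ u v : Fin n → ℝ, NP (u + v) ≤ NP u + NP v)
    (hNP_smul : ∀ (t : ℝ) (u : Fin n → ℝ), NP (t • u) = |t| * NP u)
    (hNP_def : ∀ u : Fin n → ℝ, NP u = 0 ↔ u = 0)
    (γ : ℝ) (hγ0 : 0 < γ) (hγ1 : γ ≤ 1)
    (hNPdec : ∀ (u v : Fin n → ℝ) (Su Sv : Finset (Fin g)), Disjoint Su Sv →
      Function.support u ⊆ ↑(Su.biUnion G) → Function.support v ⊆ ↑(Sv.biUnion G) →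
      NP u + γ * NP v ≤ NP (u + v))
    -- the constants `a, b`
    (a b : ℝ) (ha : 0 < a) (hb : 0 < b)
    (hab : ∀ u : Fin n → ℝ, (∃ Λ, GkS G k Λ ∧ Function.support u ⊆ ↑Λ) →
      a * NA u ≤ NP u ∧ NP u ≤ b * NA u)
    -- pairwise disjoint group `k`-sparse sets `Λ_0,…,Λ_s` whose union is `{1,…,n}`
    (s : ℕ) (Λ : Fin (s + 1) → Finset (Fin n))
    (hΛ : ∀ i, GkS G k (Λ i))
    (hΛdisj : ∀ i j : Fin (s + 1), i ≠ j → Disjoint (Λ i) (Λ j))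
    (hΛunion : Finset.univ.biUnion Λ = (Finset.univ : Finset (Fin n)))
    -- `x̂` with `‖x̂‖_P ≤ ‖x‖_P`
    (x xh : Fin n → ℝ) (hopt : NP xh ≤ NP x)
    -- abbreviations
    (h : Fin n → ℝ) (hh : h = xh - x)
    (r : ℝ) (hr : r = b / (a * γ)) :
    NA (restr (Λ 0)ᶜ h) ≤ r * NA (restr (Λ 0) h) + r * (1 + γ) * NA (restr (Λ 0)ᶜ x) := by
  classical
  choose S hSΛ using fun i => (hΛ i).1
  have hS : ∀ i j, i ≠ j → Disjoint (S i) (S j) := by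
    intro i j hij
    refine Finset.disjoint_left.mpr fun l hi hj => ?_
    obtain ⟨m, hm⟩ := hne l
    refine absurd ?_ (Finset.disjoint_left.mp (hΛdisj i j hij) (?_ : m ∈ Λ i))
    · rw [hSΛ j]
      exact Finset.mem_biUnion.mpr ⟨l, hj, hm⟩
    · rw [hSΛ i]
      exact Finset.mem_biUnion.mpr ⟨l, hi, hm⟩
  have hNA0 : NA 0 = 0 := (hNA_def 0).mpr rfl
  have hNP0 : NP 0 = 0 := (hNP_def 0).mpr rfl
  set T : Finset (Fin (s + 1)) := Finset.univ.erase 0 with hT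
  have h0T : (0 : Fin (s + 1)) ∉ T := by simp [hT]
  have hTins : insert 0 T = Finset.univ := Finset.insert_erase (Finset.mem_univ _)
  have hdT : Disjoint (Λ 0) (T.biUnion Λ) :=
    (Finset.disjoint_biUnion_right _ _ _).mpr fun j hj =>
      hΛdisj 0 j (ne_of_mem_of_not_mem hj h0T).symm
  have hunion : Λ 0 ∪ T.biUnion Λ = Finset.univ := by
    rw [← Finset.biUnion_insert, hTins, hΛunion]
  have hcompl : (Λ 0)ᶜ = T.biUnion Λ :=
    (IsCompl.of_eq (Finset.disjoint_iff_inter_eq_empty.mp hdT) hunion).compl_eq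
  have hsplit (u : Fin n → ℝ) : u = restr (Λ 0) u + restr (T.biUnion Λ) u := by
    rw [← restr_union hdT, hunion, restr_univ]
  have hblock (u : Fin n → ℝ) (i : Fin (s + 1)) :=
    hab (restr (Λ i) u) ⟨Λ i, hΛ i, support_restr_subset _ u⟩
  have hNA_le (u : Fin n → ℝ) := restr_biUnion_le_sum hNA0 hNA_add hΛdisj u T
  have hNA_ge (u : Fin n → ℝ) :
      ∑ i ∈ T, NA (restr (Λ i) u) ≤ NA (restr (T.biUnion Λ) u) := by
    have h1 := add_mul_sum_le_restr_biUnion (N := NA) (γ := 1)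
      (fun u v Su Sv hd hu hv => by rw [one_mul, hNAdec u v Su Sv hd hu hv])
      hS hSΛ hΛdisj u 0 T h0T
    rw [Finset.biUnion_insert, restr_union hdT] at h1
    linarith [hNA_add (restr (Λ 0) u) (restr (T.biUnion Λ) u)]
  have hsum_lower (u : Fin n → ℝ) :
      a * NA (restr (T.biUnion Λ) u) ≤ ∑ i ∈ T, NP (restr (Λ i) u) :=
    calc a * NA (restr (T.biUnion Λ) u)
        ≤ a * ∑ i ∈ T, NA (restr (Λ i) u) := by gcongr; exact hNA_le u
      _ ≤ ∑ i ∈ T, NP (restr (Λ i) u) := by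
        rw [Finset.mul_sum]
        exact Finset.sum_le_sum fun i _ => (hblock u i).1
  have hsum_upper (u : Fin n → ℝ) :
      ∑ i ∈ T, NP (restr (Λ i) u) ≤ b * NA (restr (T.biUnion Λ) u) :=
    calc ∑ i ∈ T, NP (restr (Λ i) u)
        ≤ b * ∑ i ∈ T, NA (restr (Λ i) u) := by
          rw [Finset.mul_sum]
          exact Finset.sum_le_sum fun i _ => (hblock u i).2
      _ ≤ b * NA (restr (T.biUnion Λ) u) := by gcongr; exact hNA_ge u
  have hneg (N : (Fin n → ℝ) → ℝ) (hN : ∀ (t : ℝ) u, N (t • u) = |t| * N u)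
      (u : Fin n → ℝ) : N (-u) = N u := by
    simpa using hN (-1) u
  have hx_upper : NP x ≤ NP (restr (Λ 0) x) + b * NA (restr (T.biUnion Λ) x) := by
    have h1 := hNP_add (restr (Λ 0) x) (restr (T.biUnion Λ) x)
    rw [← hsplit x] at h1
    linarith [restr_biUnion_le_sum hNP0 hNP_add hΛdisj x T, hsum_upper x]
  have hxh_lower :
      NP (restr (Λ 0) xh) + γ * (a * NA (restr (T.biUnion Λ) xh)) ≤ NP xh := by
    have h1 := add_mul_sum_le_restr_biUnion hNPdec hS hSΛ hΛdisj xh 0 T h0T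
    rw [hTins, hΛunion, restr_univ] at h1
    linarith [mul_le_mul_of_nonneg_left (hsum_lower xh) hγ0.le]
  have hxh : xh = x + h := by rw [hh]; abel
  have hP0 : NP (restr (Λ 0) x) ≤ NP (restr (Λ 0) xh) + NP (restr (Λ 0) h) := by
    have h1 := hNP_add (restr (Λ 0) xh) (-restr (Λ 0) h)
    rwa [hneg NP hNP_smul, hxh, restr_add, add_neg_cancel_right, ← restr_add, ← hxh] at h1
  have hAc : NA (restr (T.biUnion Λ) h) ≤
      NA (restr (T.biUnion Λ) xh) + NA (restr (T.biUnion Λ) x) := by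
    have h1 := hNA_add (restr (T.biUnion Λ) xh) (-restr (T.biUnion Λ) x)
    rwa [hneg NA hNA_smul, hxh, restr_add, add_neg_cancel_comm, ← restr_add, ← hxh] at h1
  have hmain : NA (restr (T.biUnion Λ) h) * (a * γ) ≤
      b * (NA (restr (Λ 0) h) + (1 + γ) * NA (restr (T.biUnion Λ) x)) := by
    have h1 := mul_le_mul_of_nonneg_left hAc (mul_pos ha hγ0).le
    have h2 := mul_le_mul_of_nonneg_left ((hsum_lower x).trans (hsum_upper x)) hγ0.le
    linarith [(hblock h 0).2]
  rw [hcompl, hr]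
  calc NA (restr (T.biUnion Λ) h)
      ≤ b * (NA (restr (Λ 0) h) + (1 + γ) * NA (restr (T.biUnion Λ) x)) / (a * γ) :=
        (le_div_iff₀ (mul_pos ha hγ0)).mpr hmain
    _ = _ := by ring
end
end

section
/- Suppose A ∈ ℝ^{m×n} satisfies the restricted isometry property of order 2k with constant δ = δ_{2k} satisfying δ < √2 − 1. Let x ∈ ℝ^n, y = Ax + η with ‖η‖₂ ≤ ε, and let x̂ minimize ‖z‖₁ over all z ∈ ℝ^n with ‖y − Az‖₂ ≤ ε. Then ‖x̂ − x‖₁ ≤ 2·(1 + (√2−1)δ)/(1 − (1+√2)δ)·σ_k(x,‖·‖₁) + 4√k·√(1+δ)/(1 − (1+√2)δ)·ε. -/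
noncomputable section

open Finset

/-- The Euclidean norm on `ℝ^n`. -/
def norm2 {n : ℕ} (x : Fin n → ℝ) : ℝ := Real.sqrt (∑ i, (x i) ^ 2)

/-- The ℓ₁-norm on `ℝ^n`. -/
def norm1 {n : ℕ} (x : Fin n → ℝ) : ℝ := ∑ i, |x i|

/-- `A` satisfies the restricted isometry property of order `t` with constant `δ`. -/
def RIP {m n : ℕ} (A : Matrix (Fin m) (Fin n) ℝ) (t : ℕ) (δ : ℝ) : Prop :=
  ∀ u : Fin n → ℝ, (Finset.univ.filter (fun i => u i ≠ 0)).card ≤ t →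
    (1 - δ) * (norm2 u) ^ 2 ≤ (norm2 (A.mulVec u)) ^ 2 ∧
    (norm2 (A.mulVec u)) ^ 2 ≤ (1 + δ) * (norm2 u) ^ 2

lemma norm2_nonneg {n : ℕ} (x : Fin n → ℝ) : 0 ≤ norm2 x := Real.sqrt_nonneg _

lemma norm2_sq {n : ℕ} (x : Fin n → ℝ) : norm2 x ^ 2 = x ⬝ᵥ x := by
  rw [norm2, Real.sq_sqrt (Finset.sum_nonneg fun i _ => sq_nonneg _)]
  simp [dotProduct, sq]

lemma norm2_sub_le {n : ℕ} (x y : Fin n → ℝ) : norm2 (x - y) ≤ norm2 x + norm2 y := by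
  have h := norm_sub_le (WithLp.toLp 2 x : EuclideanSpace ℝ (Fin n)) (WithLp.toLp 2 y)
  simpa [EuclideanSpace.norm_eq, norm2] using h

lemma dotProduct_le_norm2 {n : ℕ} (x y : Fin n → ℝ) : x ⬝ᵥ y ≤ norm2 x * norm2 y :=
  Real.sum_mul_le_sqrt_mul_sqrt _ _ _

lemma eq_zero_of_norm2_eq_zero {n : ℕ} {x : Fin n → ℝ} (h : norm2 x = 0) : x = 0 := by
  rw [← dotProduct_self_eq_zero, ← norm2_sq, h]
  norm_num

lemma restr_add_restr_sdiff {n : ℕ} {T S : Finset (Fin n)} (hT : T ⊆ S) (h : Fin n → ℝ) :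
    restr T h + restr (S \ T) h = restr S h := by
  funext i
  have := @hT i
  by_cases h1 : i ∈ T <;> by_cases h2 : i ∈ S <;> simp_all [restr]

lemma norm2_restr_sq {n : ℕ} (T : Finset (Fin n)) (h : Fin n → ℝ) :
    norm2 (restr T h) ^ 2 = ∑ i ∈ T, |h i| ^ 2 := by
  rw [norm2_sq]
  simp [dotProduct, restr, Finset.sum_ite_mem, sq]

lemma norm2_restr_le {n k : ℕ} {T : Finset (Fin n)} {h : Fin n → ℝ} {M : ℝ} (hM : 0 ≤ M)
    (hT : T.card ≤ k) (hb : ∀ i ∈ T, |h i| ≤ M) : norm2 (restr T h) ≤ √k * M := by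
  refine le_of_sq_le_sq ?_ (by positivity)
  rw [norm2_restr_sq, mul_pow, Real.sq_sqrt (Nat.cast_nonneg k)]
  calc ∑ i ∈ T, |h i| ^ 2 ≤ ∑ _i ∈ T, M ^ 2 :=
        Finset.sum_le_sum fun i hi => pow_le_pow_left₀ (abs_nonneg _) (hb i hi) 2
    _ = T.card * M ^ 2 := by simp
    _ ≤ k * M ^ 2 := by gcongr

lemma sum_abs_le_norm2_restr {n k : ℕ} {T : Finset (Fin n)} (h : Fin n → ℝ) (hT : T.card ≤ k) :
    ∑ i ∈ T, |h i| ≤ √k * norm2 (restr T h) := by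
  refine le_of_sq_le_sq ?_ (mul_nonneg (Real.sqrt_nonneg _) (norm2_nonneg _))
  rw [mul_pow, norm2_restr_sq, Real.sq_sqrt (Nat.cast_nonneg k)]
  refine sq_sum_le_card_mul_sum_sq.trans ?_
  gcongr

/-- Vectors supported on disjoint sets of total size at most `t` have almost orthogonal images
under a matrix with the restricted isometry property of order `t`. -/
lemma RIP.abs_dotProduct_le {m n t : ℕ} {A : Matrix (Fin m) (Fin n) ℝ} {δ : ℝ} (hA : RIP A t δ)
    {S T : Finset (Fin n)} (hST : Disjoint S T) (hcard : S.card + T.card ≤ t) (h : Fin n → ℝ) :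
    |A.mulVec (restr S h) ⬝ᵥ A.mulVec (restr T h)|
      ≤ δ * norm2 (restr S h) * norm2 (restr T h) := by
  have horth : restr S h ⬝ᵥ restr T h = 0 := by
    refine Finset.sum_eq_zero fun i _ => ?_
    have hi : i ∈ S → i ∉ T := fun h1 => Finset.disjoint_left.mp hST h1
    by_cases h1 : i ∈ S <;> simp_all [restr]
  have hsupp : ∀ a b : ℝ,
      (Finset.univ.filter fun i => (a • restr S h + b • restr T h) i ≠ 0).card ≤ t := by
    intro a b
    refine (Finset.card_le_card ?_).trans ((Finset.card_union_le S T).trans hcard)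
    intro i hi
    by_contra hc
    simp_all [restr]
  set u := restr S h
  set v := restr T h
  have hnorm : ∀ a b : ℝ,
      norm2 (a • u + b • v) ^ 2 = a ^ 2 * norm2 u ^ 2 + b ^ 2 * norm2 v ^ 2 := by
    intro a b
    simp only [norm2_sq, add_dotProduct, dotProduct_add, smul_dotProduct, dotProduct_smul,
      dotProduct_comm v u, horth, smul_eq_mul]
    ring
  have himage : ∀ a b : ℝ, norm2 (A.mulVec (a • u + b • v)) ^ 2
      = a ^ 2 * norm2 (A.mulVec u) ^ 2 + b ^ 2 * norm2 (A.mulVec v) ^ 2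
        + 2 * a * b * (A.mulVec u ⬝ᵥ A.mulVec v) := by
    intro a b
    simp only [norm2_sq, Matrix.mulVec_add, Matrix.mulVec_smul, add_dotProduct, dotProduct_add,
      smul_dotProduct, dotProduct_smul, dotProduct_comm (A.mulVec v) (A.mulVec u), smul_eq_mul]
    ring
  rcases eq_or_ne (norm2 u) 0 with hu | hu
  · simp [eq_zero_of_norm2_eq_zero hu, norm2]
  rcases eq_or_ne (norm2 v) 0 with hv | hv
  · simp [eq_zero_of_norm2_eq_zero hv, norm2]
  have hu' := lt_of_le_of_ne (norm2_nonneg u) hu.symm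
  have hv' := lt_of_le_of_ne (norm2_nonneg v) hv.symm
  have hplus := hA _ (hsupp (norm2 v) (norm2 u))
  have hminus := hA _ (hsupp (norm2 v) (-norm2 u))
  rw [hnorm, himage] at hplus hminus
  have huv : 0 < 4 * (norm2 u * norm2 v) := by positivity
  rw [abs_le]
  constructor
  · refine le_of_mul_le_mul_left ?_ huv
    linarith [hplus.1, hminus.2]
  · refine le_of_mul_le_mul_left ?_ huv
    linarith [hplus.2, hminus.1]

lemma exists_subset_card_eq_min_dominating {ι : Type*} [DecidableEq ι] (S : Finset ι)
    (f : ι → ℝ) (k : ℕ) :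
    ∃ T ⊆ S, T.card = min k S.card ∧ ∀ i ∈ T, ∀ j ∈ S \ T, f j ≤ f i := by
  induction k with
  | zero => exact ⟨∅, by simp⟩
  | succ k ih =>
    obtain ⟨T, hTS, hcard, hdom⟩ := ih
    rcases (S \ T).eq_empty_or_nonempty with he | hne
    · have hST : S = T := (Finset.sdiff_eq_empty_iff_subset.mp he).antisymm hTS
      exact ⟨T, hTS, by rw [hST] at hcard ⊢; omega, hdom⟩
    · obtain ⟨a, ha, hmax⟩ := Finset.exists_max_image (S \ T) f hne
      have ha' := Finset.mem_sdiff.mp ha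
      have hlt : T.card < S.card :=
        Finset.card_lt_card ⟨hTS, fun hc => ha'.2 (hc ha'.1)⟩
      refine ⟨insert a T, Finset.insert_subset ha'.1 hTS, ?_, ?_⟩
      · rw [Finset.card_insert_of_notMem ha'.2]
        omega
      · intro i hi j hj
        have hj' : j ∈ S \ T := by simp_all
        rcases Finset.mem_insert.mp hi with rfl | hi
        · exact hmax j hj'
        · exact hdom i hi j hj'

/-- A block of at most `k` elements of `S` containing the largest values of `f`, together with a
threshold separating it from the rest of `S`. -/
lemma exists_block_threshold {ι : Type*} [DecidableEq ι] (S : Finset ι) {f : ι → ℝ}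
    (hf : ∀ i, 0 ≤ f i) {k : ℕ} (hk : 0 < k) :
    ∃ T ⊆ S, T.card ≤ k ∧ (S.Nonempty → T.Nonempty) ∧
      ∃ M, 0 ≤ M ∧ k * M ≤ ∑ i ∈ T, f i ∧ ∀ i ∈ S \ T, f i ≤ M := by
  obtain ⟨T, hTS, hcard, hdom⟩ := exists_subset_card_eq_min_dominating S f k
  refine ⟨T, hTS, by omega, fun hS => ?_, ?_⟩
  · have := hS.card_pos
    exact Finset.card_pos.mp (by omega)
  rcases (S \ T).eq_empty_or_nonempty with he | hne
  · exact ⟨0, le_rfl, by simpa using Finset.sum_nonneg fun i _ => hf i, by simp [he]⟩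
  · obtain ⟨a, ha, hmax⟩ := Finset.exists_max_image (S \ T) f hne
    have ha' := Finset.mem_sdiff.mp ha
    have hlt : T.card < S.card := Finset.card_lt_card ⟨hTS, fun hc => ha'.2 (hc ha'.1)⟩
    have hTk : T.card = k := by omega
    refine ⟨f a, hf a, ?_, hmax⟩
    have := Finset.card_nsmul_le_sum T f (f a) fun i hi => hdom i hi a ha
    rwa [hTk, nsmul_eq_mul] at this

/-- The block-by-block estimate: splitting `R` into blocks of size `k` by decreasing magnitude
bounds the correlation between the images of `h` on `S` and on `R`. -/
lemma RIP.abs_dotProduct_tail_le {m n k : ℕ} (hk : 0 < k) {A : Matrix (Fin m) (Fin n) ℝ} {δ : ℝ}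
    (hδ : 0 ≤ δ) (hA : RIP A (2 * k) δ) (h : Fin n → ℝ) {S : Finset (Fin n)} (hS : S.card ≤ k)
    (R : Finset (Fin n)) (hSR : Disjoint S R) {M : ℝ} (hM : 0 ≤ M) (hR : ∀ i ∈ R, |h i| ≤ M) :
    √k * |A.mulVec (restr S h) ⬝ᵥ A.mulVec (restr R h)|
      ≤ δ * norm2 (restr S h) * (k * M + ∑ i ∈ R, |h i|) := by
  induction R using Finset.strongInduction generalizing M with
  | H R ih =>
    have hN := mul_nonneg hδ (norm2_nonneg (restr S h))
    have hkR : √(k : ℝ) * √k = k := Real.mul_self_sqrt (Nat.cast_nonneg k)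
    rcases R.eq_empty_or_nonempty with rfl | hne
    · have h0 : restr ∅ h = 0 := by funext i; simp [restr]
      simp only [h0, Matrix.mulVec_zero, dotProduct_zero, abs_zero, mul_zero]
      exact mul_nonneg hN (by simp; positivity)
    obtain ⟨T, hTR, hTk, hTne, M', hM', hsum, hrest⟩ :=
      exists_block_threshold R (fun i => abs_nonneg (h i)) hk
    have hhead := hA.abs_dotProduct_le (hSR.mono_right hTR) (by omega) h
    have hT2 := norm2_restr_le hM hTk fun i hi => hR i (hTR hi)
    have htail := ih (R \ T) (Finset.sdiff_ssubset hTR (hTne hne))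
      (hSR.mono_right Finset.sdiff_subset) hM' hrest
    have hsplit := Finset.sum_sdiff hTR (f := fun i => |h i|)
    rw [← restr_add_restr_sdiff hTR h, Matrix.mulVec_add, dotProduct_add]
    calc √k * |A.mulVec (restr S h) ⬝ᵥ A.mulVec (restr T h)
            + A.mulVec (restr S h) ⬝ᵥ A.mulVec (restr (R \ T) h)|
        ≤ √k * |A.mulVec (restr S h) ⬝ᵥ A.mulVec (restr T h)|
            + √k * |A.mulVec (restr S h) ⬝ᵥ A.mulVec (restr (R \ T) h)| := by
          rw [← mul_add]
          gcongr
          exact abs_add_le _ _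
      _ ≤ √k * (δ * norm2 (restr S h) * (√k * M))
            + δ * norm2 (restr S h) * (k * M' + ∑ i ∈ R \ T, |h i|) := by
          gcongr
          exact hhead.trans (by gcongr)
      _ = δ * norm2 (restr S h) * (k * M + (k * M' + ∑ i ∈ R \ T, |h i|)) := by
          linear_combination δ * norm2 (restr S h) * M * hkR
      _ ≤ δ * norm2 (restr S h) * (k * M + ∑ i ∈ R, |h i|) := by
          gcongr
          linarith

/-- Robust null space property derived from the restricted isometry property. -/
lemma RIP.sum_abs_le {m n k : ℕ} (hk : 0 < k) {A : Matrix (Fin m) (Fin n) ℝ} {δ : ℝ}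
    (hδ : 0 ≤ δ) (hA : RIP A (2 * k) δ) (h : Fin n → ℝ) {S : Finset (Fin n)}
    (hS : S.card ≤ k) :
    (1 - δ) * ∑ i ∈ S, |h i|
      ≤ √k * √(1 + δ) * norm2 (A.mulVec h) + √2 * δ * ∑ i ∈ Sᶜ, |h i| := by
  obtain ⟨T, hTS, hTk, -, M, hM, hsum, hrest⟩ :=
    exists_block_threshold Sᶜ (fun i => abs_nonneg (h i)) hk
  have hST : Disjoint S T := disjoint_compl_right.mono_right hTS
  have htailS := hA.abs_dotProduct_tail_le hk hδ h hS (Sᶜ \ T)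
    (disjoint_compl_right.mono_right Finset.sdiff_subset) hM hrest
  have htailT := hA.abs_dotProduct_tail_le hk hδ h hTk (Sᶜ \ T) Finset.disjoint_sdiff hM hrest
  have hsplit := Finset.sum_sdiff hTS (f := fun i => |h i|)
  have hbound : k * M + ∑ i ∈ Sᶜ \ T, |h i| ≤ ∑ i ∈ Sᶜ, |h i| := by linarith
  set B := ∑ i ∈ Sᶜ, |h i|
  have hB0 : 0 ≤ B := Finset.sum_nonneg fun i _ => abs_nonneg _
  have hU : restr S h + restr T h = restr (S ∪ T) h := by
    rw [← restr_add_restr_sdiff (Finset.subset_union_left : S ⊆ S ∪ T) h,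
      Finset.union_sdiff_cancel_left hST]
  have hdecomp : restr (S ∪ T) h + restr (Sᶜ \ T) h = h := by
    rw [← hU, add_assoc, restr_add_restr_sdiff hTS h]
    funext i
    by_cases hi : i ∈ S <;> simp [restr, hi]
  have hsq : norm2 (restr (S ∪ T) h) ^ 2 = norm2 (restr S h) ^ 2 + norm2 (restr T h) ^ 2 := by
    simp only [norm2_restr_sq, Finset.sum_union hST]
  have hcard : (Finset.univ.filter fun i => restr (S ∪ T) h i ≠ 0).card ≤ 2 * k := by
    refine (Finset.card_le_card (t := S ∪ T) ?_).trans
      ((Finset.card_union_le S T).trans (by omega))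
    intro i hi
    by_contra hc
    simp_all [restr]
  have hrip := hA _ hcard
  have hl1 := sum_abs_le_norm2_restr h hS
  set N := norm2 (restr (S ∪ T) h)
  set a := norm2 (restr S h)
  set b := norm2 (restr T h)
  have hN0 : 0 ≤ N := norm2_nonneg _
  have ha0 : 0 ≤ a := norm2_nonneg _
  have hb0 : 0 ≤ b := norm2_nonneg _
  have haN : a ≤ N := le_of_sq_le_sq (by nlinarith) hN0
  have habN : a + b ≤ √2 * N := by
    refine le_of_sq_le_sq ?_ (by positivity)
    rw [mul_pow, Real.sq_sqrt zero_le_two]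
    nlinarith [sq_nonneg (a - b)]
  have hAN : norm2 (A.mulVec (restr (S ∪ T) h)) ≤ √(1 + δ) * N := by
    refine le_of_sq_le_sq ?_ (by positivity)
    rw [mul_pow, Real.sq_sqrt (by linarith)]
    exact hrip.2
  have hself : norm2 (A.mulVec (restr (S ∪ T) h)) ^ 2
      = A.mulVec (restr (S ∪ T) h) ⬝ᵥ A.mulVec h
        - A.mulVec (restr S h) ⬝ᵥ A.mulVec (restr (Sᶜ \ T) h)
        - A.mulVec (restr T h) ⬝ᵥ A.mulVec (restr (Sᶜ \ T) h) := by
    nth_rewrite 3 [← hdecomp]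
    rw [norm2_sq, Matrix.mulVec_add, dotProduct_add, ← hU, Matrix.mulVec_add]
    simp only [add_dotProduct]
    ring
  have hcs : A.mulVec (restr (S ∪ T) h) ⬝ᵥ A.mulVec h ≤ √(1 + δ) * N * norm2 (A.mulVec h) :=
    (dotProduct_le_norm2 _ _).trans (mul_le_mul_of_nonneg_right hAN (norm2_nonneg _))
  have hE0 := norm2_nonneg (A.mulVec h)
  have hS' := (htailS.trans (mul_le_mul_of_nonneg_left hbound (by positivity)))
  have hT' := (htailT.trans (mul_le_mul_of_nonneg_left hbound (by positivity)))
  have hmain : N * (√k * ((1 - δ) * N))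
      ≤ N * (√k * √(1 + δ) * norm2 (A.mulVec h) + √2 * δ * B) := by
    calc N * (√k * ((1 - δ) * N)) = √k * ((1 - δ) * N ^ 2) := by ring
      _ ≤ √k * (√(1 + δ) * N * norm2 (A.mulVec h)
            + |A.mulVec (restr S h) ⬝ᵥ A.mulVec (restr (Sᶜ \ T) h)|
            + |A.mulVec (restr T h) ⬝ᵥ A.mulVec (restr (Sᶜ \ T) h)|) := by
          gcongr
          linarith [hrip.1, neg_le_abs (A.mulVec (restr S h) ⬝ᵥ A.mulVec (restr (Sᶜ \ T) h)),
            neg_le_abs (A.mulVec (restr T h) ⬝ᵥ A.mulVec (restr (Sᶜ \ T) h))]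
      _ ≤ √k * (√(1 + δ) * N * norm2 (A.mulVec h)) + δ * (a + b) * B := by linarith
      _ ≤ √k * (√(1 + δ) * N * norm2 (A.mulVec h)) + δ * (√2 * N) * B := by gcongr
      _ = N * (√k * √(1 + δ) * norm2 (A.mulVec h) + √2 * δ * B) := by ring
  have hrhs : 0 ≤ √k * √(1 + δ) * norm2 (A.mulVec h) + √2 * δ * B := by positivity
  have hSum0 : 0 ≤ ∑ i ∈ S, |h i| := Finset.sum_nonneg fun i _ => abs_nonneg _
  rcases le_total (1 - δ) 0 with hδ1 | hδ1
  · exact (mul_nonpos_of_nonpos_of_nonneg hδ1 hSum0).trans hrhs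
  have hNbound : √k * ((1 - δ) * N) ≤ √k * √(1 + δ) * norm2 (A.mulVec h) + √2 * δ * B := by
    rcases hN0.eq_or_lt with h0 | hpos
    · rw [← h0]
      simpa using hrhs
    · exact le_of_mul_le_mul_left hmain hpos
  calc (1 - δ) * ∑ i ∈ S, |h i| ≤ (1 - δ) * (√k * N) := by
        gcongr
        exact hl1.trans (by gcongr)
    _ = √k * ((1 - δ) * N) := by ring
    _ ≤ _ := hNbound

/-- The cone condition satisfied by the error of a vector of smaller `ℓ₁`-norm. -/
lemma sum_compl_abs_sub_le {n : ℕ} {x z : Fin n → ℝ} (hz : norm1 z ≤ norm1 x)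
    (S : Finset (Fin n)) :
    ∑ i ∈ Sᶜ, |(z - x) i| ≤ ∑ i ∈ S, |(z - x) i| + 2 * norm1 (x - restr S x) := by
  have hres : norm1 (x - restr S x) = ∑ i ∈ Sᶜ, |x i| := by
    rw [norm1, ← Finset.sum_add_sum_compl S,
      Finset.sum_eq_zero (s := S) fun i hi => by simp [restr, hi], zero_add]
    exact Finset.sum_congr rfl fun i hi => by simp [restr, Finset.mem_compl.mp hi]
  rw [norm1, norm1, ← Finset.sum_add_sum_compl S, ← Finset.sum_add_sum_compl S fun i => |x i|] at hz
  have hin : ∑ i ∈ S, |x i| ≤ ∑ i ∈ S, |z i| + ∑ i ∈ S, |(z - x) i| := by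
    rw [← Finset.sum_add_distrib]
    refine Finset.sum_le_sum fun i _ => ?_
    simpa using abs_sub (z i) (z i - x i)
  have hout : ∑ i ∈ Sᶜ, |(z - x) i| ≤ ∑ i ∈ Sᶜ, |z i| + ∑ i ∈ Sᶜ, |x i| := by
    rw [← Finset.sum_add_distrib]
    exact Finset.sum_le_sum fun i _ => abs_sub (z i) (x i)
  rw [hres]
  linarith

/-- conventional sparsity, ℓ₁ bound:
`‖x̂ − x‖₁ ≤ 2·(1+(√2−1)δ)/(1−(1+√2)δ)·σ_k(x,‖·‖₁) + 4√k·√(1+δ)/(1−(1+√2)δ)·ε`. -/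
theorem stmt12 {m n k : ℕ} (hk : 0 < k)
    (A : Matrix (Fin m) (Fin n) ℝ)
    (δ : ℝ) (hδ0 : 0 < δ) (hδ : δ < Real.sqrt 2 - 1)
    (hRIP : RIP A (2 * k) δ)
    -- measurements `y = Ax + η`, `‖η‖₂ ≤ ε`
    (x : Fin n → ℝ) (η : Fin m → ℝ) (ε : ℝ) (hε : 0 ≤ ε) (hη : norm2 η ≤ ε)
    (y : Fin m → ℝ) (hy : y = A.mulVec x + η)
    -- `x̂` minimizes `‖z‖₁` subject to `‖y − Az‖₂ ≤ ε`
    (xh : Fin n → ℝ)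
    (hfeas : norm2 (y - A.mulVec xh) ≤ ε)
    (hopt : ∀ z : Fin n → ℝ, norm2 (y - A.mulVec z) ≤ ε → norm1 xh ≤ norm1 z)
    -- the `k`-sparsity index `σ = σ_k(x, ‖·‖₁)`
    (σ : ℝ)
    (hσ : σ = sInf {t : ℝ | ∃ Λ : Finset (Fin n), Λ.card ≤ k ∧ t = norm1 (x - restr Λ x)}) :
    norm1 (xh - x)
      ≤ 2 * ((1 + (Real.sqrt 2 - 1) * δ) / (1 - (1 + Real.sqrt 2) * δ)) * σ
        + (4 * Real.sqrt k * Real.sqrt (1 + δ) / (1 - (1 + Real.sqrt 2) * δ)) * ε := by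
  have hs2 : √2 * √2 = (2 : ℝ) := Real.mul_self_sqrt zero_le_two
  have hs1 : 1 < √2 := by
    rw [Real.lt_sqrt zero_le_one]
    norm_num
  have hD : 0 < 1 - (1 + √2) * δ := by nlinarith
  have hnum : 0 < 1 + (√2 - 1) * δ := by nlinarith
  have hmeas : norm2 (A.mulVec (xh - x)) ≤ 2 * ε := by
    have heq : A.mulVec (xh - x) = η - (y - A.mulVec xh) := by
      rw [hy, Matrix.mulVec_sub]
      abel
    rw [heq]
    linarith [norm2_sub_le η (y - A.mulVec xh)]
  have hl1 : norm1 xh ≤ norm1 x := hopt x (by simpa [hy] using hη)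
  have hΛ : ∀ Λ : Finset (Fin n), Λ.card ≤ k →
      norm1 (xh - x) * (1 - (1 + √2) * δ)
        ≤ 2 * (1 + (√2 - 1) * δ) * norm1 (x - restr Λ x) + 4 * √k * √(1 + δ) * ε := by
    intro Λ hcard
    have hnsp := hRIP.sum_abs_le hk hδ0.le (xh - x) hcard
    have hcone := sum_compl_abs_sub_le hl1 Λ
    have hterm : √k * √(1 + δ) * norm2 (A.mulVec (xh - x)) ≤ √k * √(1 + δ) * (2 * ε) := by
      gcongr
    rw [norm1, ← Finset.sum_add_sum_compl Λ]
    linarith [mul_le_mul_of_nonneg_left hcone hnum.le]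
  have hne : {t : ℝ | ∃ Λ : Finset (Fin n), Λ.card ≤ k ∧ t = norm1 (x - restr Λ x)}.Nonempty :=
    ⟨_, ∅, by simp, rfl⟩
  have hσle : (norm1 (xh - x) * (1 - (1 + √2) * δ) - 4 * √k * √(1 + δ) * ε)
      / (2 * (1 + (√2 - 1) * δ)) ≤ σ := by
    rw [hσ]
    refine le_csInf hne ?_
    rintro t ⟨Λ, hcard, rfl⟩
    rw [div_le_iff₀ (by positivity)]
    linarith [hΛ Λ hcard]
  rw [div_le_iff₀ (by positivity)] at hσle
  have hfinal : norm1 (xh - x)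
      ≤ (2 * (1 + (√2 - 1) * δ) * σ + 4 * √k * √(1 + δ) * ε) / (1 - (1 + √2) * δ) := by
    rw [le_div_iff₀ hD]
    linarith
  refine hfinal.trans_eq ?_
  ring
end
end
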